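/- Main Theorem, addendum (singularities of large index in the dense regime): Fix an integer k ≥ 2 and let q : ℕ → ℝ with 0 ≤ q(h) ≤ 1 for all h. If h·(1 − q(h)) → ∞ and h²·q(h) → ∞ as h → ∞, then P_{h,1−q(h)}({S ⊆ R_h : some S-adjacent pair u, v has det(u,v) ≥ k}) → 1 as h → ∞. That is, with high probability the random toric surface has a singularity of index at least k. -/

import Mathlib

open Filter Topology

/-- A vector `u ∈ ℤ²` is primitive if it is nonzero and its coordinates are coprime. -/
def Primitive (u : ℤ × ℤ) : Prop := u ≠ 0 ∧ Int.gcd u.1 u.2 = 1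

/-- The sup norm of a lattice vector, as a natural number. -/
def hgt (u : ℤ × ℤ) : ℕ := max u.1.natAbs u.2.natAbs

/-- The determinant of the `2 × 2` matrix with columns `u` and `v`. -/
def det2 (u v : ℤ × ℤ) : ℤ := u.1 * v.2 - u.2 * v.1

/-- `w` lies in the open cone `{a·u + b·v : a, b ∈ ℝ, a > 0, b > 0}`. -/
def InOpenCone (u v w : ℤ × ℤ) : Prop :=
  ∃ a b : ℝ, 0 < a ∧ 0 < b ∧
    (w.1 : ℝ) = a * u.1 + b * v.1 ∧ (w.2 : ℝ) = a * u.2 + b * v.2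

open Classical in
/-- The set of primitive vectors of sup norm at most `h` (the rays of the complete fan `Σ_h`). -/
noncomputable def rays (h : ℕ) : Finset (ℤ × ℤ) :=
  (Finset.Icc (-(h : ℤ), -(h : ℤ)) ((h : ℤ), (h : ℤ))).filter (fun u => Primitive u)

/-- `u` and `v` are `S`-adjacent: both lie in `S`, `det(u,v) > 0`, and no element of `S`
lies in the open cone between them.  `S`-adjacent pairs span the 2-dimensional cones of
the completed fan of `S`. -/
def SAdj (S : Finset (ℤ × ℤ)) (u v : ℤ × ℤ) : Prop :=
  u ∈ S ∧ v ∈ S ∧ 0 < det2 u v ∧ ∀ w ∈ S, ¬ InOpenCone u v w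

open Classical in
/-- The probability, under the distribution `T(h, p)` (each ray of `Σ_h` kept
independently with probability `p`), of the set of fans whose ray set satisfies `A`. -/
noncomputable def prob (h : ℕ) (p : ℝ) (A : Finset (ℤ × ℤ) → Prop) : ℝ :=
  ∑ S ∈ (rays h).powerset,
    if A S then p ^ S.card * (1 - p) ^ ((rays h).card - S.card) else 0

section Probability

variable {h : ℕ} {p : ℝ} {A : Finset (ℤ × ℤ) → Prop}

/-- The expectation of `f` under the distribution `T(h, p)`. -/
noncomputable def mean (h : ℕ) (p : ℝ) (f : Finset (ℤ × ℤ) → ℝ) : ℝ :=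
  ∑ S ∈ (rays h).powerset, f S * (p ^ S.card * (1 - p) ^ ((rays h).card - S.card))

open Classical in
theorem prob_eq_mean (h : ℕ) (p : ℝ) (A : Finset (ℤ × ℤ) → Prop) :
    prob h p A = mean h p (fun S => if A S then 1 else 0) := by
  unfold prob mean
  refine Finset.sum_congr rfl fun S _ => ?_
  by_cases hA : A S <;> simp [hA]

theorem mean_mono (hp0 : 0 ≤ p) (hp1 : p ≤ 1) {f g : Finset (ℤ × ℤ) → ℝ}
    (hfg : ∀ S ⊆ rays h, f S ≤ g S) : mean h p f ≤ mean h p g := by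
  unfold mean
  refine Finset.sum_le_sum fun S hS => ?_
  have : 0 ≤ 1 - p := by linarith
  exact mul_le_mul_of_nonneg_right (hfg S (Finset.mem_powerset.1 hS)) (by positivity)

theorem mean_add (h : ℕ) (p : ℝ) (f g : Finset (ℤ × ℤ) → ℝ) :
    mean h p (fun S => f S + g S) = mean h p f + mean h p g := by
  simp [mean, add_mul, Finset.sum_add_distrib]

theorem mean_const_mul (h : ℕ) (p c : ℝ) (f : Finset (ℤ × ℤ) → ℝ) :
    mean h p (fun S => c * f S) = c * mean h p f := by
  simp [mean, mul_assoc, Finset.mul_sum]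

theorem mean_sum {ι : Type*} (h : ℕ) (p : ℝ) (I : Finset ι) (f : ι → Finset (ℤ × ℤ) → ℝ) :
    mean h p (fun S => ∑ i ∈ I, f i S) = ∑ i ∈ I, mean h p (f i) := by
  simp only [mean, Finset.sum_mul]
  rw [Finset.sum_comm]

/-- Prescribing that the rays in `K` are kept and those in `D` are deleted has
probability `p ^ |K| * (1 - p) ^ |D|`. -/
theorem prob_cylinder (p : ℝ) {K D : Finset (ℤ × ℤ)} (hK : K ⊆ rays h) (hD : D ⊆ rays h)
    (hKD : Disjoint K D) :
    prob h p (fun S => K ⊆ S ∧ Disjoint D S) = p ^ K.card * (1 - p) ^ D.card := by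
  classical
  have key := Finset.prod_add (fun i => if i ∈ D then 0 else p)
    (fun i => if i ∈ K then 0 else 1 - p) (rays h)
  have hprod : ∀ i ∈ rays h, ((if i ∈ D then 0 else p) + (if i ∈ K then 0 else 1 - p))
      = (if i ∈ K then p else 1) * (if i ∈ D then 1 - p else 1) := by
    intro i _
    by_cases h1 : i ∈ K
    · have : i ∉ D := Finset.disjoint_left.1 hKD h1
      simp [h1, this]
    · by_cases h2 : i ∈ D <;> simp [h1, h2]
  rw [Finset.prod_congr rfl hprod, Finset.prod_mul_distrib, Finset.prod_ite, Finset.prod_ite,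
    Finset.filter_mem_eq_inter, Finset.filter_mem_eq_inter, Finset.inter_eq_right.2 hK,
    Finset.inter_eq_right.2 hD] at key
  simp only [Finset.prod_const, one_pow, mul_one] at key
  rw [key, prob]
  refine Finset.sum_congr rfl fun S hS => ?_
  have hS' := Finset.mem_powerset.1 hS
  split_ifs with hc
  · have e1 : ∀ i ∈ S, (if i ∈ D then 0 else p) = p := fun i hi =>
      if_neg fun hiD => Finset.disjoint_left.1 hc.2 hiD hi
    have e2 : ∀ i ∈ rays h \ S, (if i ∈ K then 0 else 1 - p) = 1 - p := fun i hi =>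
      if_neg fun hiK => (Finset.mem_sdiff.1 hi).2 (hc.1 hiK)
    rw [Finset.prod_congr rfl e1, Finset.prod_congr rfl e2, Finset.prod_const, Finset.prod_const,
      Finset.card_sdiff_of_subset hS']
  · by_cases hKS : K ⊆ S
    · obtain ⟨i, hiD, hiS⟩ := Finset.not_disjoint_iff.1 fun hd => hc ⟨hKS, hd⟩
      rw [Finset.prod_eq_zero hiS (by simp [hiD]), zero_mul]
    · obtain ⟨i, hiK, hiS⟩ := Finset.not_subset.1 hKS
      rw [Finset.prod_eq_zero (s := rays h \ S) (Finset.mem_sdiff.2 ⟨hK hiK, hiS⟩) (by simp [hiK]),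
        mul_zero]

theorem mean_one (h : ℕ) (p : ℝ) : mean h p (fun _ => 1) = 1 := by
  have := prob_cylinder (h := h) p (Finset.empty_subset _) (Finset.empty_subset _)
    (Finset.disjoint_empty_left _)
  simpa [prob_eq_mean] using this

theorem prob_add_prob_not (h : ℕ) (p : ℝ) (A : Finset (ℤ × ℤ) → Prop) :
    prob h p A + prob h p (fun S => ¬ A S) = 1 := by
  rw [prob_eq_mean, prob_eq_mean, ← mean_add]
  refine Eq.trans ?_ (mean_one h p)
  congr 1
  funext S
  by_cases hA : A S <;> simp [hA]

theorem prob_nonneg (hp0 : 0 ≤ p) (hp1 : p ≤ 1) : 0 ≤ prob h p A := by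
  have : 0 ≤ 1 - p := by linarith
  unfold prob
  refine Finset.sum_nonneg fun S _ => ?_
  split_ifs <;> positivity

theorem prob_le_add_add {A₁ A₂ A₃ : Finset (ℤ × ℤ) → Prop} (hp0 : 0 ≤ p) (hp1 : p ≤ 1)
    (hA : ∀ S ⊆ rays h, A S → A₁ S ∨ A₂ S ∨ A₃ S) :
    prob h p A ≤ prob h p A₁ + prob h p A₂ + prob h p A₃ := by
  simp only [prob_eq_mean, ← mean_add]
  refine mean_mono hp0 hp1 fun S hS => ?_
  have := hA S hS
  by_cases h0 : A S <;> by_cases h1 : A₁ S <;> by_cases h2 : A₂ S <;> by_cases h3 : A₃ S <;>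
    (simp_all; try norm_num)

/-- Second moment bound: among independent cylinder events of the same probability
`r = p ^ a * (1 - p) ^ b`, indexed by `I`, none occurs with probability at most
`1 / (|I| * r)`. -/
theorem card_mul_prob_forall_not_cylinder_le {ι : Type*} (hp0 : 0 ≤ p) (hp1 : p ≤ 1)
    (I : Finset ι) (K D : ι → Finset (ℤ × ℤ)) (a b : ℕ)
    (hK : ∀ i ∈ I, K i ⊆ rays h ∧ (K i).card = a) (hD : ∀ i ∈ I, D i ⊆ rays h ∧ (D i).card = b)
    (hKD : ∀ i ∈ I, ∀ j ∈ I, Disjoint (K i) (D j))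
    (hKK : ∀ i ∈ I, ∀ j ∈ I, i ≠ j → Disjoint (K i) (K j))
    (hDD : ∀ i ∈ I, ∀ j ∈ I, i ≠ j → Disjoint (D i) (D j))
    (hA : ∀ S ⊆ rays h, A S → ∀ i ∈ I, ¬ (K i ⊆ S ∧ Disjoint (D i) S)) :
    (I.card * (p ^ a * (1 - p) ^ b)) * prob h p A ≤ 1 := by
  classical
  set r := p ^ a * (1 - p) ^ b with hr
  have hq : 0 ≤ 1 - p := by linarith
  have hr0 : 0 ≤ r := by positivity
  set e : ι → Finset (ℤ × ℤ) → ℝ := fun i S => if K i ⊆ S ∧ Disjoint (D i) S then 1 else 0 with he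
  have h1 : ∀ i ∈ I, mean h p (e i) = r := by
    intro i hi
    have := prob_cylinder p (hK i hi).1 (hD i hi).1 (hKD i hi i hi)
    rw [prob_eq_mean, (hK i hi).2, (hD i hi).2] at this
    convert this using 1
    congr!
  have h2 : ∀ i ∈ I, ∀ j ∈ I, mean h p (fun S => e i S * e j S) ≤ r ^ 2 + if i = j then r else 0 := by
    intro i hi j hj
    by_cases hij : i = j
    · subst hij
      have : (fun S => e i S * e i S) = e i := by
        funext S
        simp only [he]
        split_ifs <;> simp
      rw [this, h1 i hi, if_pos rfl]
      nlinarith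
    · have := prob_cylinder p (Finset.union_subset (hK i hi).1 (hK j hj).1)
        (Finset.union_subset (hD i hi).1 (hD j hj).1) (by
          simp only [Finset.disjoint_union_left, Finset.disjoint_union_right]
          exact ⟨⟨hKD i hi i hi, hKD j hj i hi⟩, hKD i hi j hj, hKD j hj j hj⟩)
      rw [prob_eq_mean, Finset.card_union_of_disjoint (hKK i hi j hj hij),
        Finset.card_union_of_disjoint (hDD i hi j hj hij), (hK i hi).2, (hD i hi).2,
        (hK j hj).2, (hD j hj).2] at this
      have h3 : (fun S => e i S * e j S) = fun S =>
          if K i ∪ K j ⊆ S ∧ Disjoint (D i ∪ D j) S then 1 else 0 := by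
        funext S
        simp only [he, Finset.union_subset_iff, Finset.disjoint_union_left]
        by_cases c1 : K i ⊆ S <;> by_cases c2 : K j ⊆ S <;> by_cases c3 : Disjoint (D i) S <;>
          by_cases c4 : Disjoint (D j) S <;> simp [c1, c2, c3, c4]
      rw [h3, if_neg hij]
      refine le_of_eq ?_
      convert this using 1
      · congr!
      · rw [hr]
        ring
  set n : ℝ := (I.card : ℝ) with hn
  have hvar : mean h p (fun S => (n * r) ^ 2 * if A S then 1 else 0)
      ≤ mean h p (fun S => ((∑ i ∈ I, ∑ j ∈ I, e i S * e j S)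
        + ((-2 * (n * r)) * ∑ i ∈ I, e i S)) + (n * r) ^ 2 * 1) := by
    refine mean_mono hp0 hp1 fun S hS => ?_
    have hsq : (∑ i ∈ I, ∑ j ∈ I, e i S * e j S) = (∑ i ∈ I, e i S) ^ 2 := by
      rw [sq, Finset.sum_mul_sum]
    rw [hsq]
    split_ifs with hc
    · have : ∑ i ∈ I, e i S = 0 := Finset.sum_eq_zero fun i hi => by
        simp only [he]
        rw [if_neg (hA S hS hc i hi)]
      rw [this]
      linarith
    · nlinarith [sq_nonneg ((∑ i ∈ I, e i S) - n * r)]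
  rw [mean_const_mul, ← prob_eq_mean, mean_add, mean_add, mean_const_mul, mean_const_mul,
    mean_one, mean_sum, mean_sum, Finset.sum_congr rfl h1] at hvar
  have hdouble : ∑ i ∈ I, mean h p (fun S => ∑ j ∈ I, e i S * e j S) ≤ n ^ 2 * r ^ 2 + n * r := by
    calc ∑ i ∈ I, mean h p (fun S => ∑ j ∈ I, e i S * e j S)
        ≤ ∑ i ∈ I, ∑ j ∈ I, (r ^ 2 + if i = j then r else 0) := by
          refine Finset.sum_le_sum fun i hi => ?_
          rw [mean_sum]
          exact Finset.sum_le_sum fun j hj => h2 i hi j hj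
      _ = n ^ 2 * r ^ 2 + n * r := by
          simp [Finset.sum_add_distrib, hn]
          ring
  have hfin : (n * r) * ((n * r) * prob h p A) ≤ (n * r) * 1 := by
    simp only [Finset.sum_const, nsmul_eq_mul] at hvar
    rw [← hn] at hvar
    nlinarith
  rcases (mul_nonneg (Nat.cast_nonneg I.card) hr0 : 0 ≤ n * r).eq_or_lt with h0 | h0
  · rw [← h0]
    simp
  · exact le_of_mul_le_mul_left hfin h0

end Probability

section Lattice

theorem mem_rays {h : ℕ} {u : ℤ × ℤ} :
    u ∈ rays h ↔ (-(h : ℤ) ≤ u.1 ∧ u.1 ≤ h) ∧ (-(h : ℤ) ≤ u.2 ∧ u.2 ≤ h) ∧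
      IsCoprime u.1 u.2 := by
  simp only [rays, Finset.mem_filter, Finset.mem_Icc, Primitive, ← Int.isCoprime_iff_gcd_eq_one,
    Prod.le_def]
  constructor
  · rintro ⟨⟨⟨_, _⟩, _, _⟩, _, _⟩
    exact ⟨⟨by assumption, by assumption⟩, ⟨by assumption, by assumption⟩, by assumption⟩
  · rintro ⟨⟨h1, h2⟩, ⟨h3, h4⟩, h5⟩
    refine ⟨⟨⟨h1, h3⟩, h2, h4⟩, ?_, h5⟩
    rintro rfl
    simp [isCoprime_zero_left] at h5

theorem InOpenCone.det2_pos {u v w : ℤ × ℤ} (hw : InOpenCone u v w) (huv : 0 < det2 u v) :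
    0 < det2 u w ∧ 0 < det2 w v := by
  obtain ⟨a, b, ha, hb, h1, h2⟩ := hw
  have hd : (0 : ℝ) < (u.1 : ℝ) * v.2 - u.2 * v.1 := by exact_mod_cast huv
  constructor
  · have : (0 : ℝ) < (u.1 : ℝ) * w.2 - u.2 * w.1 := by
      rw [h1, h2]
      nlinarith [mul_pos hb hd]
    exact_mod_cast this
  · have : (0 : ℝ) < (w.1 : ℝ) * v.2 - w.2 * v.1 := by
      rw [h1, h2]
      nlinarith [mul_pos ha hd]
    exact_mod_cast this

theorem InOpenCone.fst_pos {u v w : ℤ × ℤ} (hw : InOpenCone u v w) (hu : 0 < u.1) (hv : 0 < v.1) :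
    0 < w.1 := by
  obtain ⟨a, b, ha, hb, h1, -⟩ := hw
  have hu' : (0 : ℝ) < u.1 := by exact_mod_cast hu
  have hv' : (0 : ℝ) < v.1 := by exact_mod_cast hv
  have : (0 : ℝ) < w.1 := by
    rw [h1]
    positivity
  exact_mod_cast this

/-- If the ray `(1, 0)` is deleted and rays `(x, 1)`, `(x', -1)` with `x, x' ≥ k` are kept, the
cone containing `(1, 0)` has index at least `k`. -/
theorem exists_sAdj_of_not_mem {h k : ℕ} {S : Finset (ℤ × ℤ)} (hS : S ⊆ rays h) (hk : 0 < k)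
    (h0 : ((1 : ℤ), (0 : ℤ)) ∉ S) (hpos : ∃ x : ℤ, (k : ℤ) ≤ x ∧ (x, (1 : ℤ)) ∈ S)
    (hneg : ∃ x : ℤ, (k : ℤ) ≤ x ∧ (x, (-1 : ℤ)) ∈ S) :
    ∃ u v : ℤ × ℤ, SAdj S u v ∧ (k : ℤ) ≤ det2 u v := by
  classical
  have hk' : (0 : ℤ) < k := by exact_mod_cast hk
  obtain ⟨x, hx, hxS⟩ := hpos
  obtain ⟨x', hx', hxS'⟩ := hneg
  obtain ⟨v, hv, hvmin⟩ := Finset.exists_min_image (S.filter fun z => 0 < z.1 ∧ 0 < z.2)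
    (fun z => (z.2 : ℚ) / z.1)
    ⟨(x, 1), Finset.mem_filter.2 ⟨hxS, by dsimp only; omega, by norm_num⟩⟩
  obtain ⟨u, hu, humax⟩ := Finset.exists_max_image (S.filter fun z => 0 < z.1 ∧ z.2 < 0)
    (fun z => (z.2 : ℚ) / z.1)
    ⟨(x', -1), Finset.mem_filter.2 ⟨hxS', by dsimp only; omega, by norm_num⟩⟩
  obtain ⟨hvS, hv1, hv2⟩ := Finset.mem_filter.1 hv
  obtain ⟨huS, hu1, hu2⟩ := Finset.mem_filter.1 hu
  have hvmin' : ∀ z ∈ S, 0 < z.1 → 0 < z.2 → v.2 * z.1 ≤ z.2 * v.1 := by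
    intro z hz h1 h2
    have := hvmin z (Finset.mem_filter.2 ⟨hz, h1, h2⟩)
    rw [div_le_div_iff₀ (by exact_mod_cast hv1) (by exact_mod_cast h1)] at this
    exact_mod_cast this
  have humax' : ∀ z ∈ S, 0 < z.1 → z.2 < 0 → z.2 * u.1 ≤ u.2 * z.1 := by
    intro z hz h1 h2
    have := humax z (Finset.mem_filter.2 ⟨hz, h1, h2⟩)
    rw [div_le_div_iff₀ (by exact_mod_cast h1) (by exact_mod_cast hu1)] at this
    exact_mod_cast this
  have hxv := hvmin' _ hxS (by dsimp only; omega) (by norm_num)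
  have hxu := humax' _ hxS' (by dsimp only; omega) (by norm_num)
  dsimp only at hxv hxu
  have hvk : (k : ℤ) ≤ v.1 := by nlinarith
  have huk : (k : ℤ) ≤ u.1 := by nlinarith
  have hdet : (k : ℤ) ≤ det2 u v := by
    unfold det2
    nlinarith [mul_pos (neg_pos.2 hu2) hv1]
  refine ⟨u, v, ⟨huS, hvS, by omega, fun z hz hcone => ?_⟩, hdet⟩
  have hz1 := hcone.fst_pos hu1 hv1
  obtain ⟨hd1, hd2⟩ := hcone.det2_pos (by omega)
  unfold det2 at hd1 hd2
  rcases lt_trichotomy z.2 0 with hz2 | hz2 | hz2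
  · have := humax' z hz hz1 hz2
    linarith
  · have hcop := (mem_rays.1 (hS hz)).2.2
    rw [hz2, isCoprime_zero_right, Int.isUnit_iff] at hcop
    have : z = (1, 0) := Prod.ext (by dsimp only; omega) hz2
    exact h0 (this ▸ hz)
  · have := hvmin' z hz hz1 hz2
    linarith

/-- `u` and `v` are the Farey neighbours of order `h` of `w`, before and after it. -/
structure FareyNeighbours (h : ℕ) (w u v : ℤ × ℤ) : Prop where
  left_mem : u ∈ rays h
  right_mem : v ∈ rays h
  left_det : det2 u w = 1
  right_det : det2 w v = 1
  left_lt : h < u.1 + w.1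
  right_lt : h < v.1 + w.1

theorem exists_det_eq {x y : ℤ} (hx : 0 < x) (hxy : IsCoprime x y) (n c : ℤ) :
    ∃ s t : ℤ, s * y - t * x = c ∧ n < s + x ∧ s ≤ n := by
  obtain ⟨a, b, hab⟩ := hxy
  refine ⟨c * b + x * ((n - c * b) / x), -c * a + y * ((n - c * b) / x), ?_, ?_, ?_⟩
  · linear_combination c * hab
  · have := Int.lt_mul_ediv_self_add (x := n - c * b) hx
    linarith
  · have := Int.mul_ediv_self_le (x := n - c * b) hx.ne'
    linarith

theorem exists_fareyNeighbours {h : ℕ} {w : ℤ × ℤ} (hw : IsCoprime w.1 w.2) (h0 : 0 < w.2)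
    (h1 : w.2 < w.1) (h2 : w.1 ≤ h) : ∃ u v : ℤ × ℤ, FareyNeighbours h w u v := by
  obtain ⟨x, y⟩ := w
  dsimp only at hw h0 h1 h2
  have hx : 0 < x := by omega
  obtain ⟨s, t, hst, hs1, hs2⟩ := exists_det_eq hx hw h 1
  obtain ⟨s', t', hst', hs1', hs2'⟩ := exists_det_eq hx hw h (-1)
  have hs : 0 < s := by omega
  have hs' : 0 < s' := by omega
  have ht0 : -1 < t := by
    by_contra hc
    nlinarith
  have ht1 : t < s := by
    by_contra hc
    nlinarith
  have ht0' : 0 < t' := by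
    by_contra hc
    nlinarith
  have ht1' : t' ≤ s' := by
    by_contra hc
    nlinarith
  refine ⟨(s, t), (s', t'), mem_rays.2 ⟨⟨?_, ?_⟩, ⟨?_, ?_⟩, y, -x, ?_⟩,
    mem_rays.2 ⟨⟨?_, ?_⟩, ⟨?_, ?_⟩, -y, x, ?_⟩, ?_, ?_, ?_, ?_⟩ <;>
    simp only [det2] <;> linarith

namespace FareyNeighbours

variable {h k : ℕ} {w u v w' u' v' : ℤ × ℤ}

theorem sAdj (hf : FareyNeighbours h w u v) (hwr : w ∈ rays h) (hw0 : 0 < w.1) (hk : 0 < k)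
    (hwk : (k + 1) * w.1 ≤ h) {S : Finset (ℤ × ℤ)} (hS : S ⊆ rays h) (hu : u ∈ S) (hv : v ∈ S)
    (hw : w ∉ S) : SAdj S u v ∧ (k : ℤ) ≤ det2 u v := by
  obtain ⟨-, -, hl, hr, hl', hr'⟩ := hf
  have hk' : (0 : ℤ) < k := by exact_mod_cast hk
  have hu1 : k * w.1 < u.1 := by linarith
  have hv1 : k * w.1 < v.1 := by linarith
  have hu0 : 0 < u.1 := by nlinarith
  have hv0 : 0 < v.1 := by nlinarith
  have hid : det2 u v * w.1 = u.1 + v.1 := by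
    unfold det2 at *
    linear_combination u.1 * hr + v.1 * hl
  have hdet : (k : ℤ) ≤ det2 u v := by
    by_contra hc
    nlinarith
  refine ⟨⟨hu, hv, by omega, fun z hz hcone => ?_⟩, hdet⟩
  have hz1 := hcone.fst_pos hu0 hv0
  obtain ⟨hd1, hd2⟩ := hcone.det2_pos (by omega)
  obtain ⟨⟨_, hzh⟩, _, hzc⟩ := mem_rays.1 (hS hz)
  rcases lt_trichotomy (det2 w z) 0 with hd | hd | hd
  · have : z.1 = det2 u z * w.1 - det2 w z * u.1 := by
      unfold det2 at *
      linear_combination (- z.1) * hl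
    nlinarith
  · have hwc := (mem_rays.1 hwr).2.2
    unfold det2 at hd
    have e1 : w.1 ∣ z.1 := hwc.dvd_of_dvd_mul_left ⟨z.2, by linarith⟩
    have e2 : z.1 ∣ w.1 := hzc.dvd_of_dvd_mul_right ⟨w.2, by linarith⟩
    have e3 : w.1 = z.1 := Int.dvd_antisymm hw0.le hz1.le e1 e2
    have e4 : w.2 = z.2 := by
      rw [← e3] at hd
      nlinarith
    exact hw (Prod.ext e3 e4 ▸ hz)
  · have : z.1 = det2 z v * w.1 + det2 w z * v.1 := by
      unfold det2 at *
      linear_combination (- z.1) * hr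
    nlinarith

theorem eq_of_left_eq (hf : FareyNeighbours h w u v) (hf' : FareyNeighbours h w' u' v')
    (h0 : 0 < w.1) (h0' : 0 < w'.1) (hw : 3 * w.1 ≤ h) (hw' : 3 * w'.1 ≤ h) (he : u = u') :
    w = w' := by
  subst he
  have a := hf.left_det
  have b := hf'.left_det
  have c := hf.left_lt
  unfold det2 at a b
  obtain ⟨m, hm⟩ : u.1 ∣ w'.1 - w.1 := by
    refine ((mem_rays.1 hf.left_mem).2.2).dvd_of_dvd_mul_left ⟨w'.2 - w.2, by linarith⟩
  have hm0 : m = 0 := by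
    rcases lt_trichotomy m 0 with h' | h' | h'
    · nlinarith
    · exact h'
    · nlinarith
  subst hm0
  have e : w.1 = w'.1 := by linarith
  refine Prod.ext e ?_
  rw [← e] at b
  have : u.1 * (w.2 - w'.2) = 0 := by linarith
  rcases mul_eq_zero.1 this <;> omega

theorem eq_of_right_eq (hf : FareyNeighbours h w u v) (hf' : FareyNeighbours h w' u' v')
    (h0 : 0 < w.1) (h0' : 0 < w'.1) (hw : 3 * w.1 ≤ h) (hw' : 3 * w'.1 ≤ h) (he : v = v') :
    w = w' := by
  subst he
  have a := hf.right_det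
  have b := hf'.right_det
  have c := hf.right_lt
  unfold det2 at a b
  obtain ⟨m, hm⟩ : v.1 ∣ w'.1 - w.1 := by
    refine ((mem_rays.1 hf.right_mem).2.2).dvd_of_dvd_mul_left ⟨w'.2 - w.2, by linarith⟩
  have hm0 : m = 0 := by
    rcases lt_trichotomy m 0 with h' | h' | h'
    · nlinarith
    · exact h'
    · nlinarith
  subst hm0
  have e : w.1 = w'.1 := by linarith
  refine Prod.ext e ?_
  rw [← e] at b
  have : v.1 * (w.2 - w'.2) = 0 := by linarith
  rcases mul_eq_zero.1 this <;> omega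

theorem left_ne_right (hf : FareyNeighbours h w u v) (hf' : FareyNeighbours h w' u' v')
    (h0 : 0 < w.1) (h0' : 0 < w'.1) (hw : 3 * w.1 ≤ h) (hw' : 3 * w'.1 ≤ h) : u ≠ v' := by
  rintro rfl
  have a := hf.left_det
  have b := hf'.right_det
  have c := hf.left_lt
  unfold det2 at a b
  obtain ⟨m, hm⟩ : u.1 ∣ w'.1 + w.1 := by
    refine ((mem_rays.1 hf.left_mem).2.2).dvd_of_dvd_mul_left ⟨w'.2 + w.2, by linarith⟩
  rcases le_or_gt m 0 with h' | h' <;> nlinarith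

end FareyNeighbours

end Lattice

section Counting

theorem sum_inv_sq_le (M : ℕ) : ∑ d ∈ Finset.Icc 2 M, (1 : ℝ) / (d : ℝ) ^ 2 ≤ 3 / 4 := by
  rcases lt_or_ge M 2 with hM | hM
  · rw [Finset.Icc_eq_empty (by omega)]
    norm_num
  · have : ∑ d ∈ Finset.Icc 2 M, (1 : ℝ) / (d : ℝ) ^ 2 ≤ 3 / 4 - 1 / M := by
      induction M, hM using Nat.le_induction with
      | base => norm_num
      | succ n hn ih =>
        rw [Finset.sum_Icc_succ_top (by omega)]
        have hn' : (0 : ℝ) < n := by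
          have : 0 < n := by omega
          exact_mod_cast this
        have : (1 : ℝ) / ((n + 1 : ℕ) : ℝ) ^ 2 ≤ 1 / n - 1 / ((n + 1 : ℕ) : ℝ) := by
          push_cast
          rw [div_sub_div _ _ hn'.ne' (by positivity),
            div_le_div_iff₀ (by positivity) (by positivity)]
          nlinarith
        linarith
    have : (0 : ℝ) ≤ 1 / M := by positivity
    linarith

/-- The coprime pairs of positive integers up to `M`. -/
def coprimePairs (M : ℕ) : Finset (ℕ × ℕ) :=
  (Finset.Ioc 0 M ×ˢ Finset.Ioc 0 M).filter fun z => Nat.Coprime z.1 z.2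

theorem sq_div_four_le_card_coprimePairs (M : ℕ) :
    (M : ℝ) ^ 2 / 4 ≤ ((coprimePairs M).card : ℝ) := by
  set T := Finset.Ioc 0 M ×ˢ Finset.Ioc 0 M with hT
  have hsub : (T.filter fun z => ¬ Nat.Coprime z.1 z.2) ⊆ (Finset.Icc 2 M).biUnion fun d =>
      ((Finset.Ioc 0 M).filter (d ∣ ·)) ×ˢ ((Finset.Ioc 0 M).filter (d ∣ ·)) := by
    rintro ⟨a, b⟩ hab
    simp only [hT, Finset.mem_filter, Finset.mem_product, Finset.mem_Ioc, Nat.Coprime] at hab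
    simp only [Finset.mem_biUnion, Finset.mem_filter, Finset.mem_product, Finset.mem_Ioc,
      Finset.mem_Icc]
    have hle := Nat.gcd_le_left b hab.1.1.1
    have hpos := Nat.gcd_pos_of_pos_left b hab.1.1.1
    exact ⟨Nat.gcd a b, ⟨by omega, by omega⟩, ⟨hab.1.1, Nat.gcd_dvd_left a b⟩, hab.1.2,
      Nat.gcd_dvd_right a b⟩
  have hcard : ((T.filter fun z => ¬ Nat.Coprime z.1 z.2).card : ℝ) ≤ 3 / 4 * (M : ℝ) ^ 2 := by
    have h1 := (Finset.card_le_card hsub).trans Finset.card_biUnion_le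
    simp only [Finset.card_product, Nat.Ioc_filter_dvd_card_eq_div] at h1
    calc ((T.filter fun z => ¬ Nat.Coprime z.1 z.2).card : ℝ)
        ≤ ∑ d ∈ Finset.Icc 2 M, ((M / d : ℕ) : ℝ) * ((M / d : ℕ) : ℝ) := by exact_mod_cast h1
      _ ≤ ∑ d ∈ Finset.Icc 2 M, (M : ℝ) ^ 2 * (1 / (d : ℝ) ^ 2) := by
          refine Finset.sum_le_sum fun d _ => ?_
          have : ((M / d : ℕ) : ℝ) ≤ M / d := Nat.cast_div_le
          calc ((M / d : ℕ) : ℝ) * ((M / d : ℕ) : ℝ) ≤ (M / d) * (M / d) := by gcongr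
            _ = (M : ℝ) ^ 2 * (1 / (d : ℝ) ^ 2) := by ring
      _ ≤ 3 / 4 * (M : ℝ) ^ 2 := by
          rw [← Finset.mul_sum]
          nlinarith [sum_inv_sq_le M, sq_nonneg (M : ℝ)]
  have hsum := Finset.card_filter_add_card_filter_not (s := T) fun z => Nat.Coprime z.1 z.2
  have hTc : T.card = M * M := by simp [hT]
  rw [hTc] at hsum
  have hsum' : ((coprimePairs M).card : ℝ)
      + ((T.filter fun z => ¬ Nat.Coprime z.1 z.2).card : ℝ) = M * M := by
    exact_mod_cast hsum
  nlinarith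

end Counting

/-- The property of having an adjacent pair of index at least `k`. -/
def HasIndex (k : ℕ) (S : Finset (ℤ × ℤ)) : Prop :=
  ∃ u v : ℤ × ℤ, SAdj S u v ∧ (k : ℤ) ≤ det2 u v

theorem one_sub_pow_mul_le {p : ℝ} (hp1 : p ≤ 1) (m : ℕ) :
    (m * p) * (1 - p) ^ m ≤ 1 := by
  have h1 : (1 - p) ^ m ≤ Real.exp (-(m * p)) := by
    rw [← mul_neg, Real.exp_nat_mul]
    exact pow_le_pow_left₀ (by linarith) (by linarith [Real.add_one_le_exp (-p)]) m
  rcases le_or_gt (m * p) 0 with h0 | h0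
  · have : 0 ≤ (1 - p) ^ m := pow_nonneg (by linarith) m
    nlinarith
  · calc (m * p) * (1 - p) ^ m ≤ (m * p) * Real.exp (-(m * p)) := by gcongr
      _ ≤ Real.exp (m * p) * Real.exp (-(m * p)) := by
          gcongr
          linarith [Real.add_one_le_exp (m * p)]
      _ = 1 := by rw [← Real.exp_add, add_neg_cancel, Real.exp_zero]

/-- No ray `(x, c)` with `k ≤ x ≤ h` is kept with probability at most `1 / ((h + 1 - k) p)`. -/
theorem mul_prob_forall_not_mem_le {h k : ℕ} {p : ℝ} (hp1 : p ≤ 1) {c : ℤ} (hh : 0 < h)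
    (hk : 0 < k) (hc : IsUnit c) :
    (((h + 1 - k : ℕ) : ℝ) * p) *
      prob h p (fun S => ∀ x : ℤ, (k : ℤ) ≤ x → x ≤ h → (x, c) ∉ S) ≤ 1 := by
  set D : Finset (ℤ × ℤ) := (Finset.Icc (k : ℤ) h).image fun x => (x, c) with hD
  have hDc : D.card = h + 1 - k := by
    rw [hD, Finset.card_image_of_injective _ fun a b hab => (Prod.ext_iff.1 hab).1, Int.card_Icc]
    omega
  have hDr : D ⊆ rays h := by
    intro z hz
    obtain ⟨x, hx, rfl⟩ := Finset.mem_image.1 hz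
    obtain ⟨hx1, hx2⟩ := Finset.mem_Icc.1 hx
    have hc' := Int.isUnit_iff.1 hc
    refine mem_rays.2 ⟨⟨?_, ?_⟩, ⟨?_, ?_⟩, ?_⟩ <;> dsimp only
    · omega
    · omega
    · omega
    · omega
    · exact (isCoprime_one_right (x := x)).of_isCoprime_of_dvd_right hc.dvd
  have hprob := prob_cylinder p (Finset.empty_subset _) hDr (Finset.disjoint_empty_left _)
  have hev : (fun S : Finset (ℤ × ℤ) => ∀ x : ℤ, (k : ℤ) ≤ x → x ≤ h → (x, c) ∉ S)
      = fun S => ∅ ⊆ S ∧ Disjoint D S := by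
    funext S
    simp only [hD, Finset.empty_subset, true_and, Finset.disjoint_left, Finset.forall_mem_image,
      Finset.mem_Icc, and_imp]
  rw [hev, hprob, hDc, Finset.card_empty, pow_zero, one_mul]
  exact one_sub_pow_mul_le hp1 _

theorem prob_not_hasIndex_le_sparse {h k : ℕ} {p : ℝ} (hp0 : 0 ≤ p) (hp1 : p ≤ 1) (hh : 0 < h)
    (hk : 0 < k) (hpos : 0 < ((h + 1 - k : ℕ) : ℝ) * p) :
    prob h p (fun S => ¬ HasIndex k S) ≤ p + 2 / (((h + 1 - k : ℕ) : ℝ) * p) := by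
  have hA := prob_le_add_add (h := h) (A := fun S => ¬ HasIndex k S)
    (A₁ := fun S => {((1 : ℤ), (0 : ℤ))} ⊆ S ∧ Disjoint ∅ S)
    (A₂ := fun S => ∀ x : ℤ, (k : ℤ) ≤ x → x ≤ h → (x, (1 : ℤ)) ∉ S)
    (A₃ := fun S => ∀ x : ℤ, (k : ℤ) ≤ x → x ≤ h → (x, (-1 : ℤ)) ∉ S) hp0 hp1 (by
      intro S hS hn
      by_contra! hc
      obtain ⟨hc1, ⟨x, hx, -, hxS⟩, x', hx', -, hxS'⟩ := hc
      refine hn (exists_sAdj_of_not_mem hS hk (fun hm => ?_) ⟨x, hx, hxS⟩ ⟨x', hx', hxS'⟩)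
      exact hc1 (Finset.singleton_subset_iff.2 hm) (Finset.disjoint_empty_left _))
  have h1 := prob_cylinder (h := h) p (K := {((1 : ℤ), (0 : ℤ))}) (D := ∅)
    (Finset.singleton_subset_iff.2 (mem_rays.2
      ⟨⟨by dsimp only; omega, by dsimp only; omega⟩, ⟨by dsimp only; omega, by dsimp only; omega⟩,
        isCoprime_one_left⟩))
    (Finset.empty_subset _) (Finset.disjoint_empty_right _)
  have h2 := mul_prob_forall_not_mem_le (p := p) hp1 hh hk isUnit_one
  have h3 := mul_prob_forall_not_mem_le (p := p) hp1 hh hk isUnit_one.neg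
  rw [← le_div_iff₀' hpos] at h2 h3
  rw [h1] at hA
  have : (2 : ℝ) / (((h + 1 - k : ℕ) : ℝ) * p) = 1 / (((h + 1 - k : ℕ) : ℝ) * p)
    + 1 / (((h + 1 - k : ℕ) : ℝ) * p) := by ring
  simp only [Finset.card_singleton, Finset.card_empty, pow_one, pow_zero, mul_one] at hA
  linarith

theorem mul_prob_not_hasIndex_le_dense {h k M : ℕ} {p : ℝ} (hp0 : 0 ≤ p) (hp1 : p ≤ 1)
    (hk : 2 ≤ k) (hM : 2 * (k + 1) * M ≤ h) :
    ((M : ℝ) ^ 2 / 4 * (p ^ 2 * (1 - p))) * prob h p (fun S => ¬ HasIndex k S) ≤ 1 := by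
  set W : ℕ × ℕ → ℤ × ℤ := fun z => ((z.1 : ℤ) + z.2, (z.2 : ℤ)) with hWdef
  have hWinj : ∀ i j, W i = W j → i = j := by
    rintro ⟨a, b⟩ ⟨c, d⟩ hij
    simp only [hWdef, Prod.mk.injEq] at hij
    ext <;> dsimp only <;> omega
  have hW : ∀ z ∈ coprimePairs M, IsCoprime (W z).1 (W z).2 ∧ 0 < (W z).2 ∧ (W z).2 < (W z).1 ∧
      ((k : ℤ) + 1) * (W z).1 ≤ h := by
    rintro ⟨a, b⟩ hz
    simp only [coprimePairs, Finset.mem_filter, Finset.mem_product, Finset.mem_Ioc] at hz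
    obtain ⟨⟨⟨ha, haM⟩, hb, hbM⟩, hab⟩ := hz
    refine ⟨?_, ?_, ?_, ?_⟩ <;> simp only [hWdef]
    · have := (Nat.isCoprime_iff_coprime.2 hab).add_mul_right_left 1
      simpa using this
    · exact_mod_cast hb
    · omega
    · have h1 : (k + 1) * (a + b) ≤ h := by
        calc (k + 1) * (a + b) ≤ (k + 1) * (2 * M) := Nat.mul_le_mul_left _ (by omega)
          _ = 2 * (k + 1) * M := by ring
          _ ≤ h := hM
      exact_mod_cast h1
  have hW3 : ∀ z ∈ coprimePairs M, 0 < (W z).1 ∧ 3 * (W z).1 ≤ h := by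
    intro z hz
    obtain ⟨-, h1, h2, h3⟩ := hW z hz
    have : (2 : ℤ) ≤ k := by exact_mod_cast hk
    exact ⟨by omega, by nlinarith⟩
  have hex : ∀ z ∈ coprimePairs M, ∃ n : (ℤ × ℤ) × (ℤ × ℤ),
      FareyNeighbours h (W z) n.1 n.2 := by
    intro z hz
    obtain ⟨h0, h1, h2, -⟩ := hW z hz
    obtain ⟨u, v, huv⟩ := exists_fareyNeighbours h0 h1 h2 (by linarith [hW3 z hz])
    exact ⟨(u, v), huv⟩
  choose! n hn using hex
  have hWr : ∀ z ∈ coprimePairs M, W z ∈ rays h := by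
    intro z hz
    obtain ⟨h0, h1, h2, -⟩ := hW z hz
    have := hW3 z hz
    exact mem_rays.2 ⟨⟨by omega, by omega⟩, ⟨by omega, by omega⟩, h0⟩
  have key := card_mul_prob_forall_not_cylinder_le (h := h) (A := fun S => ¬ HasIndex k S) hp0 hp1
    (coprimePairs M) (fun z => {(n z).1, (n z).2}) (fun z => {W z}) 2 1 ?_ ?_ ?_ ?_ ?_ ?_
  · rw [pow_one] at key
    have h0 : 0 ≤ p ^ 2 * (1 - p) := mul_nonneg (sq_nonneg p) (by linarith)
    refine le_trans (mul_le_mul_of_nonneg_right (mul_le_mul_of_nonneg_right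
      (sq_div_four_le_card_coprimePairs M) h0) (prob_nonneg hp0 hp1)) key
  · intro i hi
    have a := hn i hi
    have b := hW3 i hi
    refine ⟨?_, Finset.card_pair (a.left_ne_right a b.1 b.1 b.2 b.2)⟩
    simp [Finset.insert_subset_iff, a.left_mem, a.right_mem]
  · intro i hi
    exact ⟨Finset.singleton_subset_iff.2 (hWr i hi), Finset.card_singleton _⟩
  · intro i hi j hj
    have a := (hn i hi).left_lt
    have a' := (hn i hi).right_lt
    have b := hW3 i hi
    have b' := hW3 j hj
    simp only [Finset.disjoint_singleton_right, Finset.mem_insert, Finset.mem_singleton]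
    rintro (hc | hc) <;> rw [hc] at b' <;> omega
  · intro i hi j hj hij
    have b := hW3 i hi
    have b' := hW3 j hj
    have e1 := (hn i hi).eq_of_left_eq (hn j hj) b.1 b'.1 b.2 b'.2
    have e2 := (hn i hi).eq_of_right_eq (hn j hj) b.1 b'.1 b.2 b'.2
    have e3 := (hn i hi).left_ne_right (hn j hj) b.1 b'.1 b.2 b'.2
    have e4 := (hn j hj).left_ne_right (hn i hi) b'.1 b.1 b'.2 b.2
    simp only [Finset.disjoint_insert_left, Finset.disjoint_singleton_left, Finset.mem_insert,
      Finset.mem_singleton, not_or]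
    exact ⟨⟨fun hc => hij (hWinj _ _ (e1 hc)), e3⟩, fun hc => e4 hc.symm,
      fun hc => hij (hWinj _ _ (e2 hc))⟩
  · intro i _ j _ hij
    exact Finset.disjoint_singleton.2 fun hc => hij (hWinj _ _ hc)
  · intro S hS hbad i hi hc
    have hW0 := hW3 i hi
    refine hbad ⟨_, _, (hn i hi).sAdj (hWr i hi) hW0.1 (by omega) (hW i hi).2.2.2 hS
      (hc.1 (by simp)) (hc.1 (by simp)) (Finset.disjoint_singleton_left.1 hc.2)⟩

theorem tendsto_prob_not_hasIndex (k : ℕ) (hk : 2 ≤ k) (q : ℕ → ℝ)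
    (hq : ∀ h, 0 ≤ q h ∧ q h ≤ 1)
    (h1 : Tendsto (fun h : ℕ => (h : ℝ) * (1 - q h)) atTop atTop)
    (h2 : Tendsto (fun h : ℕ => (h : ℝ) ^ 2 * q h) atTop atTop) :
    Tendsto (fun h : ℕ => prob h (1 - q h) (fun S => ¬ HasIndex k S)) atTop (nhds 0) := by
  rw [Metric.tendsto_atTop']
  intro ε hε
  have hK : (0 : ℝ) < 4 * (k + 1) := by positivity
  have ev : ∀ᶠ h : ℕ in atTop, prob h (1 - q h) (fun S => ¬ HasIndex k S) < ε := by
    filter_upwards [h1.eventually_gt_atTop (8 / ε),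
      h2.eventually_gt_atTop (16 * (4 * (k + 1)) ^ 2 / ε ^ 3),
      eventually_ge_atTop (4 * (k + 1))] with h hh1 hh2 hh
    obtain ⟨hq0, hq1⟩ := hq h
    have hp0 : 0 ≤ 1 - q h := by linarith
    have hp1 : 1 - q h ≤ 1 := by linarith
    have hhR : (4 * (k + 1) : ℝ) ≤ h := by exact_mod_cast hh
    rcases le_or_gt (1 - q h) (ε / 2) with hp | hp
    · have hm : (h : ℝ) / 2 ≤ ((h + 1 - k : ℕ) : ℝ) := by
        rw [Nat.cast_sub (by omega)]
        push_cast
        linarith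
      have hlow : 4 / ε < ((h + 1 - k : ℕ) : ℝ) * (1 - q h) := by
        have : (h : ℝ) / 2 * (1 - q h) ≤ ((h + 1 - k : ℕ) : ℝ) * (1 - q h) := by gcongr
        have e : 8 / ε = 2 * (4 / ε) := by ring
        linarith
      have h4 : 0 < 4 / ε := by positivity
      have := prob_not_hasIndex_le_sparse hp0 hp1 (by omega) (by omega) (h4.trans hlow)
      have hlt : 2 / (((h + 1 - k : ℕ) : ℝ) * (1 - q h)) < ε / 2 := by
        rw [div_lt_iff₀ (h4.trans hlow)]
        rw [div_lt_iff₀ hε] at hlow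
        linarith
      linarith
    · set M := h / (2 * (k + 1)) with hMdef
      have hM : 2 * (k + 1) * M ≤ h := Nat.mul_div_le h _
      have hM' : (h : ℝ) / (4 * (k + 1)) ≤ M := by
        have : h < 2 * (k + 1) * (M + 1) := by
          rw [hMdef]
          exact Nat.lt_mul_div_succ h (by omega)
        have h3 : (h : ℝ) < 2 * (k + 1) * (M + 1) := by exact_mod_cast this
        rw [div_le_iff₀ hK]
        nlinarith
      have hd := mul_prob_not_hasIndex_le_dense hp0 hp1 hk hM
      rw [sub_sub_cancel] at hd
      by_contra! hc
      have hM2 : ((h : ℝ) / (4 * (k + 1))) ^ 2 ≤ (M : ℝ) ^ 2 := by gcongr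
      have hp2 : (ε / 2) ^ 2 ≤ (1 - q h) ^ 2 := by gcongr
      have : ((h : ℝ) / (4 * (k + 1))) ^ 2 / 4 * ((ε / 2) ^ 2 * q h) * ε ≤ 1 :=
        le_trans (by gcongr) hd
      rw [div_lt_iff₀ (by positivity)] at hh2
      have e : ((h : ℝ) / (4 * (k + 1))) ^ 2 / 4 * ((ε / 2) ^ 2 * q h) * ε
          = ((h : ℝ) ^ 2 * q h * ε ^ 3) / (16 * (4 * (k + 1)) ^ 2) := by
        field_simp
        ring
      rw [e, div_le_one (by positivity)] at this
      linarith
  obtain ⟨N, hN⟩ := eventually_atTop.1 ev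
  refine ⟨N, fun h hh => ?_⟩
  rw [Real.dist_eq, sub_zero, abs_of_nonneg
    (prob_nonneg (by linarith [(hq h).2]) (by linarith [(hq h).1]))]
  exact hN h hh.le

/-- Main Theorem, addendum: in the dense regime (`h·(1 − q(h)) → ∞` and
`h²·q(h) → ∞`), with high probability the random toric surface has a singularity
of index at least `k`. -/
theorem high_index_singularity (k : ℕ) (hk : 2 ≤ k) (q : ℕ → ℝ)
    (hq : ∀ h, 0 ≤ q h ∧ q h ≤ 1)
    (h1 : Tendsto (fun h : ℕ => (h : ℝ) * (1 - q h)) atTop atTop)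
    (h2 : Tendsto (fun h : ℕ => (h : ℝ) ^ 2 * q h) atTop atTop) :
    Tendsto (fun h : ℕ =>
        prob h (1 - q h) (fun S => ∃ u v : ℤ × ℤ, SAdj S u v ∧ (k : ℤ) ≤ det2 u v))
      atTop (nhds 1) := by
  have hlim := (tendsto_prob_not_hasIndex k hk q hq h1 h2).const_sub 1
  rw [sub_zero] at hlim
  refine hlim.congr fun h => ?_
  have := prob_add_prob_not h (1 - q h) (HasIndex k)
  change _ = prob h (1 - q h) (HasIndex k)
  linarith
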